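/- Let G = X_{14}X_{24}X_{25}X_{35} − X_{14}X_{24}X_{26}X_{35} + X_{24}X_{25}X_{35}² − X_{14}X_{26}X_{35}² − X_{25}X_{26}X_{35}² + X_{14}X_{25}X_{35}X_{36} − X_{24}X_{26}X_{35}X_{36} + X_{25}X_{26}X_{35}X_{36} + X_{25}X_{35}²X_{36} − X_{26}X_{35}²X_{36} + X_{14}X_{24}X_{25}X_{46} − X_{14}X_{24}X_{26}X_{46} + X_{24}X_{25}X_{35}X_{46} − X_{14}X_{26}X_{35}X_{46} − X_{25}X_{26}X_{35}X_{46} + X_{14}X_{24}X_{36}X_{46} + X_{14}X_{35}X_{36}X_{46} + X_{24}X_{35}X_{36}X_{46} + X_{35}²X_{36}X_{46} ∈ ℂ[X_{14}, X_{24}, X_{25}, X_{26}, X_{35}, X_{36}, X_{46}]. Then there do not exist polynomials A, B, C, D ∈ ℂ[X_{14}, X_{24}, X_{25}, X_{26}, X_{36}, X_{46}] (i.e., not involving X_{35}) such that G = (A + B·X_{35})·(C + D·X_{35}). -/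

import Mathlib

open MvPolynomial

/- Variables `X_{14}, X_{24}, X_{25}, X_{26}, X_{35}, X_{36}, X_{46}` of
`ℂ[X_{14}, X_{24}, X_{25}, X_{26}, X_{35}, X_{36}, X_{46}]`, indexed by `Fin 7`
in this order; in particular `X_{35}` is the variable with index `4`. -/
noncomputable def X14 : MvPolynomial (Fin 7) ℂ := X 0
noncomputable def X24 : MvPolynomial (Fin 7) ℂ := X 1
noncomputable def X25 : MvPolynomial (Fin 7) ℂ := X 2
noncomputable def X26 : MvPolynomial (Fin 7) ℂ := X 3
noncomputable def X35 : MvPolynomial (Fin 7) ℂ := X 4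
noncomputable def X36 : MvPolynomial (Fin 7) ℂ := X 5
noncomputable def X46 : MvPolynomial (Fin 7) ℂ := X 6

/-- The polynomial `G` from the proof of Lemma `lem:snake3d`. -/
noncomputable def G14 : MvPolynomial (Fin 7) ℂ :=
  X14*X24*X25*X35 - X14*X24*X26*X35 + X24*X25*X35^2 - X14*X26*X35^2 - X25*X26*X35^2 +
  X14*X25*X35*X36 - X24*X26*X35*X36 + X25*X26*X35*X36 + X25*X35^2*X36 - X26*X35^2*X36 +
  X14*X24*X25*X46 - X14*X24*X26*X46 + X24*X25*X35*X46 - X14*X26*X35*X46 -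
  X25*X26*X35*X46 + X14*X24*X36*X46 + X14*X35*X36*X46 + X24*X35*X36*X46 +
  X35^2*X36*X46

/-- The quadratic `5t² - 2t + 1` has nonzero discriminant, so it is not a square in `ℂ[t]`. -/
lemma sq_ne_quadratic (g : Polynomial ℂ) :
    g ^ 2 ≠ 5 * (Polynomial.X : Polynomial ℂ) ^ 2 - 2 * Polynomial.X + 1 := by
  intro h
  have hroot : (5 : ℂ) * ((1 + 2 * Complex.I) / 5) ^ 2 - 2 * ((1 + 2 * Complex.I) / 5) + 1 = 0 := by
    linear_combination (4 / 5 : ℂ) * Complex.I_sq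
  have heval := congrArg (Polynomial.eval ((1 + 2 * Complex.I) / 5)) h
  have hderiv := congrArg (fun p => (Polynomial.derivative p).eval ((1 + 2 * Complex.I) / 5)) h
  simp only [Polynomial.eval_pow, Polynomial.eval_add, Polynomial.eval_sub, Polynomial.eval_mul,
    Polynomial.eval_X, Polynomial.eval_one, Polynomial.eval_ofNat, hroot] at heval
  simp [Polynomial.derivative_pow, pow_eq_zero_iff two_ne_zero |>.mp heval] at hderiv
  have hI : Complex.I = 0 := by linear_combination -(1 / 4 : ℂ) * hderiv
  exact Complex.I_ne_zero hI

/-- The specialization `X₁₄ ↦ t`, `X₃₅ ↦ c`, all other variables to `1`. -/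
noncomputable def specialization (c : ℂ) : MvPolynomial (Fin 7) ℂ →ₐ[ℂ] Polynomial ℂ :=
  aeval ![Polynomial.X, 1, 1, 1, Polynomial.C c, 1, 1]

lemma specialization_eq_of_mem_supported {p : MvPolynomial (Fin 7) ℂ}
    (hp : p ∈ MvPolynomial.supported ℂ ({0, 1, 2, 3, 5, 6} : Set (Fin 7))) (c : ℂ) :
    specialization c p = specialization 0 p := by
  refine eval₂Hom_congr' rfl (fun i hi _ => ?_) rfl
  have hmem := mem_supported.mp hp hi
  fin_cases i <;> simp_all

lemma specialization_G14 (c : ℂ) :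
    specialization c G14 = (1 - Polynomial.X) * Polynomial.C c ^ 2
      + (1 + Polynomial.X) * Polynomial.C c + Polynomial.X := by
  simp [specialization, G14, X14, X24, X25, X26, X35, X36, X46]
  ring

lemma specialization_X35 (c : ℂ) : specialization c X35 = Polynomial.C c := by
  simp [specialization, X35]

/-- `G` admits no factorization into two factors of degree at most one in `X_{35}`:
the subalgebra `ℂ[X_{14}, X_{24}, X_{25}, X_{26}, X_{36}, X_{46}]` consists of the
polynomials supported on the variables other than `X_{35}` (index `4`). -/
theorem stmt_14 :
    ¬ ∃ A B C D : MvPolynomial (Fin 7) ℂ,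
      A ∈ MvPolynomial.supported ℂ ({0, 1, 2, 3, 5, 6} : Set (Fin 7)) ∧
      B ∈ MvPolynomial.supported ℂ ({0, 1, 2, 3, 5, 6} : Set (Fin 7)) ∧
      C ∈ MvPolynomial.supported ℂ ({0, 1, 2, 3, 5, 6} : Set (Fin 7)) ∧
      D ∈ MvPolynomial.supported ℂ ({0, 1, 2, 3, 5, 6} : Set (Fin 7)) ∧
      G14 = (A + B * X35) * (C + D * X35) := by
  rintro ⟨A, B, C, D, hA, hB, hC, hD, hG⟩
  have hspec (c : ℂ) := congrArg (specialization c) hG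
  simp only [map_mul, map_add, specialization_X35, specialization_G14,
    specialization_eq_of_mem_supported hA, specialization_eq_of_mem_supported hB,
    specialization_eq_of_mem_supported hC, specialization_eq_of_mem_supported hD] at hspec
  have h0 := hspec 0
  have h1 := hspec 1
  have h2 := hspec (-1)
  simp only [map_neg, map_one, map_zero] at h0 h1 h2
  set a := specialization 0 A
  set b := specialization 0 B
  set c := specialization 0 C
  set d := specialization 0 D
  have hconst : a * c = Polynomial.X := by linear_combination -h0
  have htwo : (2 : Polynomial ℂ) ≠ 0 := two_ne_zero
  have hlin : a * d + b * c = 1 + Polynomial.X :=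
    mul_left_cancel₀ htwo (by linear_combination h2 - h1)
  have hquad : b * d = 1 - Polynomial.X :=
    mul_left_cancel₀ htwo (by linear_combination 2 * h0 - h1 - h2)
  apply sq_ne_quadratic (a * d - b * c)
  linear_combination (a * d + b * c + 1 + Polynomial.X) * hlin - 4 * b * d * hconst
    - 4 * Polynomial.X * hquad
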